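/- Let μ, α > 0. For every N > 0, let r*(N) denote the unique solution in (0, N) of r/(μ(N − r)) = α + (1/μ)·log(N/(N − r)). Then r*(N)/N is a constant q ∈ (0, 1) independent of N, namely the unique q ∈ (0, 1) satisfying q/(1 − q) + log(1 − q) = αμ. Consequently, if G ≥ 1 groups have parameters μ_j, α_j, c_j > 0 and group sizes N_j = c_j·N, then the minimum latency T*(N) = 1/(Σ_{j=1}^{G} μ_j(N_j − r_j*(N_j))) satisfies N·T*(N) = 1/(Σ_{j=1}^{G} c_j μ_j (1 − q_j)) for all N > 0, where q_j is the constant ratio for group j; in particular T*(N) = Θ(1/N). -/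

import Mathlib

open Real

theorem aux_lt {a b : ℝ} (ha : 0 < a) (hab : a < b) (hb : b < 1) :
    a / (1 - a) + Real.log (1 - a) < b / (1 - b) + Real.log (1 - b) := by
  have hu : 0 < 1 - a := by linarith
  have hv : 0 < 1 - b := by linarith
  have h1 : Real.log ((1 - a) / (1 - b)) ≤ (1 - a) / (1 - b) - 1 :=
    Real.log_le_sub_one_of_pos (by positivity)
  rw [Real.log_div hu.ne' hv.ne'] at h1
  have h2 : b / (1 - b) - a / (1 - a) - ((1 - a) / (1 - b) - 1)
      = (b - a) * a / ((1 - a) * (1 - b)) := by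
    field_simp
    ring
  have h3 : 0 < (b - a) * a / ((1 - a) * (1 - b)) := by
    have : 0 < b - a := by linarith
    positivity
  linarith

theorem aux_inj {a b : ℝ} (ha : a ∈ Set.Ioo (0 : ℝ) 1) (hb : b ∈ Set.Ioo (0 : ℝ) 1)
    (h : a / (1 - a) + Real.log (1 - a) = b / (1 - b) + Real.log (1 - b)) : a = b := by
  rcases lt_trichotomy a b with h1 | h1 | h1
  · exact absurd h (aux_lt ha.1 h1 hb.2).ne
  · exact h1
  · exact absurd h (aux_lt hb.1 h1 ha.2).ne'

theorem aux_ratio {m al r N : ℝ} (hm : 0 < m) (hN : 0 < N) (hr : r ∈ Set.Ioo (0 : ℝ) N)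
    (h : r / (m * (N - r)) = al + (1 / m) * Real.log (N / (N - r))) :
    r / N ∈ Set.Ioo (0 : ℝ) 1 ∧ (r / N) / (1 - r / N) + Real.log (1 - r / N) = al * m := by
  obtain ⟨h0, h1⟩ := hr
  have hd : 0 < N - r := by linarith
  refine ⟨⟨by positivity, (div_lt_one hN).2 h1⟩, ?_⟩
  have e1 : 1 - r / N = (N - r) / N := by field_simp
  have e2 : (r / N) / ((N - r) / N) = m * (r / (m * (N - r))) := by field_simp
  rw [e1, e2, h, Real.log_div hN.ne' hd.ne', Real.log_div hd.ne' hN.ne']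
  field_simp
  ring

/-- The optimizer ratio `r*(N)/N` is a constant `q ∈ (0,1)` independent of `N`, the unique
solution of `q/(1−q) + log(1−q) = αμ`; consequently with group sizes `N_j = c_j·N` the
minimum latency `T*(N) = 1/(Σ_j μ_j(N_j − r_j*(N_j)))` satisfies
`N·T*(N) = 1/(Σ_j c_j μ_j (1 − q_j))`, i.e. `T*(N) = Θ(1/N)`. -/
theorem optimizer_ratio_constant_and_latency_scaling
    (G : ℕ) (hG : 1 ≤ G)
    (μ α c : Fin G → ℝ)
    (hμ : ∀ j, 0 < μ j) (hα : ∀ j, 0 < α j) (hc : ∀ j, 0 < c j)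
    (rstar : Fin G → ℝ → ℝ)
    (hrstar : ∀ j, ∀ N : ℝ, 0 < N →
      rstar j N ∈ Set.Ioo (0 : ℝ) N ∧
      rstar j N / (μ j * (N - rstar j N)) =
        α j + (1 / μ j) * Real.log (N / (N - rstar j N))) :
    ∃ q : Fin G → ℝ,
      (∀ j, q j ∈ Set.Ioo (0 : ℝ) 1 ∧
        q j / (1 - q j) + Real.log (1 - q j) = α j * μ j ∧
        (∀ q' ∈ Set.Ioo (0 : ℝ) 1,
          q' / (1 - q') + Real.log (1 - q') = α j * μ j → q' = q j) ∧
        (∀ N : ℝ, 0 < N → rstar j N / N = q j)) ∧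
      (∀ N : ℝ, 0 < N →
        N * (1 / ∑ j, μ j * (c j * N - rstar j (c j * N))) =
          1 / ∑ j, c j * μ j * (1 - q j)) := by
  have key : ∀ j, ∀ N : ℝ, 0 < N → rstar j N / N ∈ Set.Ioo (0 : ℝ) 1 ∧
      (rstar j N / N) / (1 - rstar j N / N) + Real.log (1 - rstar j N / N) = α j * μ j :=
    fun j N hN => aux_ratio (hμ j) hN (hrstar j N hN).1 (hrstar j N hN).2
  have hq : ∀ j, ∀ N : ℝ, 0 < N → rstar j N / N = rstar j 1 / 1 := fun j N hN =>
    aux_inj (key j N hN).1 (key j 1 one_pos).1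
      ((key j N hN).2.trans (key j 1 one_pos).2.symm)
  refine ⟨fun j => rstar j 1 / 1, fun j => ⟨(key j 1 one_pos).1, (key j 1 one_pos).2,
    fun q' hq' h => aux_inj hq' (key j 1 one_pos).1 (h.trans (key j 1 one_pos).2.symm),
    hq j⟩, ?_⟩
  intro N hN
  have hs : ∑ j, μ j * (c j * N - rstar j (c j * N))
      = N * ∑ j, c j * μ j * (1 - rstar j 1 / 1) := by
    rw [Finset.mul_sum]
    refine Finset.sum_congr rfl fun j _ => ?_
    have hcN : 0 < c j * N := mul_pos (hc j) hN
    have := hq j (c j * N) hcN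
    rw [div_eq_iff hcN.ne'] at this
    rw [this]
    ring
  rw [hs, one_div, mul_inv, ← mul_assoc, mul_inv_cancel₀ hN.ne', one_mul, one_div]
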